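/- arXiv:1708.06584 — 2 statements merged into one kernel-verified Lean document; each statement's English description precedes it below -/
import Mathlib

section
/- Let r and s be bounded transfinite sequences of reals of nonzero length such that ℓ(r) + ℓ(s) = ℓ(s) (ordinal addition). Then M̄(r ⊕ s) = M̄(s). -/
open Ordinal

/-- The number `n` of full blocks in the standard decomposition `o = ω^σ·n + ρ`,
where `ω^σ = ω ^ log ω o` is the largest indecomposable ordinal `≤ o`. -/
noncomputable def stdBlocks (o : Ordinal.{0}) : ℕ :=
  Cardinal.toNat (o / omega0 ^ log omega0 o).card

/-- The upper mean `M̄` of a transfinite sequence of reals.  A sequence of length `o`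
is encoded as a total function `f : Ordinal → ℝ`; only the values of `f` at ordinals
`< o` are ever used.  It is defined by transfinite recursion on `o`:
(1) for `o = 1` it is `f 0`;
(2) for `o` indecomposable with `o > 1` (i.e. `o = ω^σ` with `σ > 0`) it is
    `limsup_{ξ → o} M̄(f|_ξ) = inf_{1 ≤ ζ < o} sup_{ζ ≤ ξ < o} M̄(f|_ξ)`;
(3) for decomposable `o`, writing `o = ω^σ·n + ρ` with `ρ < ω^σ`, it is the average
    `(1/n) (M̄(s₀) + ⋯ + M̄(s_{n-1}))` of the upper means of the `n` consecutive
    blocks of `f` of length `ω^σ` (the remainder of length `ρ` is discarded). -/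
noncomputable def upperMean (o : Ordinal.{0}) (f : Ordinal.{0} → ℝ) : ℝ :=
  if o = 1 then f 0
  else if h1 : 1 < o ∧ o = omega0 ^ log omega0 o then
    ⨅ ζ : Set.Ico (1 : Ordinal.{0}) o, ⨆ ξ : Set.Ico ζ.1 o, upperMean ξ.1 f
  else if h2 : 1 < o then
    ((stdBlocks o : ℝ))⁻¹ *
      ∑ i ∈ Finset.range (stdBlocks o),
        upperMean (omega0 ^ log omega0 o)
          (fun ξ => f (omega0 ^ log omega0 o * (i : Ordinal) + ξ))
  else 0
termination_by o
decreasing_by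
  · exact ξ.2.2
  · exact lt_of_le_of_ne (opow_log_le_self _ (zero_lt_one.trans h2).ne')
      fun h => h1 ⟨h2, h.symm⟩

/-- A transfinite sequence of reals of length `o` is bounded if its range
(on indices `< o`) is bounded in `ℝ`. -/
def SeqBounded (o : Ordinal.{0}) (f : Ordinal.{0} → ℝ) : Prop :=
  ∃ C : ℝ, ∀ ξ < o, |f ξ| ≤ C

/-- The concatenation `r ⊕ s` of a sequence `r` of length `a` with a sequence `s`:
its first `a` entries are those of `r`, and its entry at `a + ξ'` is `s ξ'`. -/
noncomputable def concatSeq (a : Ordinal.{0}) (r s : Ordinal.{0} → ℝ) :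
    Ordinal.{0} → ℝ :=
  fun ξ => if ξ < a then r ξ else s (ξ - a)

/-- An ordinal is indecomposable if it is nonzero and not the sum of two strictly
smaller ordinals. -/
def IsIndecomposable (o : Ordinal.{0}) : Prop :=
  o ≠ 0 ∧ ∀ b < o, ∀ c < o, b + c ≠ o

/-- The concatenation `s₀ ⊕ s₁ ⊕ ⋯ ⊕ s_{n-1}` of `n` sequences, each of length `β`;
the result has length `β * n`. -/
noncomputable def concatN (β : Ordinal.{0}) :
    (n : ℕ) → (Fin n → Ordinal.{0} → ℝ) → Ordinal.{0} → ℝ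
  | 0, _ => fun _ => 0
  | n + 1, s => concatSeq (β * n) (concatN β n (fun i => s i.castSucc)) (s (Fin.last n))

/-- `s / β`: given a sequence `s` whose length is `β * α`, the sequence of length `α`
whose `ι`-th entry is the upper mean of the `ι`-th consecutive block of `s` of
length `β`. -/
noncomputable def seqDiv (s : Ordinal.{0} → ℝ) (β : Ordinal.{0}) : Ordinal.{0} → ℝ :=
  fun ι => upperMean β (fun ξ => s (β * ι + ξ))

/-- The lower mean `𝕄̲(s) = -M̄(-s)`. -/
noncomputable def lowerMean (o : Ordinal.{0}) (s : Ordinal.{0} → ℝ) : ℝ :=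
  - upperMean o (fun ξ => - s ξ)

/-- A sequence `s` of length `o` has mean `c` when its upper and lower means both
equal `c`. -/
def HasMean (o : Ordinal.{0}) (s : Ordinal.{0} → ℝ) (c : ℝ) : Prop :=
  upperMean o s = c ∧ lowerMean o s = c

theorem upperMean_zero (f : Ordinal.{0} → ℝ) : upperMean 0 f = 0 := by
  rw [upperMean]; simp

theorem upperMean_one (f : Ordinal.{0} → ℝ) : upperMean 1 f = f 0 := by
  rw [upperMean]; simp

theorem upperMean_opow {σ : Ordinal.{0}} (hσ : σ ≠ 0) (f : Ordinal.{0} → ℝ) :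
    upperMean (omega0 ^ σ) f =
      ⨅ ζ : Set.Ico (1 : Ordinal.{0}) (omega0 ^ σ), ⨆ ξ : Set.Ico ζ.1 (omega0 ^ σ),
        upperMean ξ.1 f := by
  have h1 : 1 < omega0 ^ σ := one_lt_opow.2 ⟨one_lt_omega0, hσ⟩
  rw [upperMean, if_neg h1.ne', dif_pos]
  exact ⟨h1, by rw [log_opow one_lt_omega0]⟩

theorem upperMean_opow_mul_add (f : Ordinal.{0} → ℝ) {σ ρ : Ordinal.{0}} {n : ℕ} (hn : n ≠ 0)
    (hρ : ρ < omega0 ^ σ) :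
    upperMean (omega0 ^ σ * n + ρ) f =
      (n : ℝ)⁻¹ * ∑ i ∈ Finset.range n,
        upperMean (omega0 ^ σ) (fun ξ => f (omega0 ^ σ * (i : Ordinal) + ξ)) := by
  have hσ : omega0 ^ σ ≠ (0 : Ordinal.{0}) := (opow_pos σ omega0_pos).ne'
  have hle : omega0 ^ σ ≤ omega0 ^ σ * n + ρ :=
    (le_mul_left _ (by exact_mod_cast Nat.pos_of_ne_zero hn)).trans le_self_add
  have hlog : log omega0 (omega0 ^ σ * n + ρ) = σ := by
    rw [log_opow_mul_add one_lt_omega0 (by exact_mod_cast hn) hρ,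
      log_eq_zero (natCast_lt_omega0 n), add_zero]
  have hdiv : (omega0 ^ σ * n + ρ) / omega0 ^ σ = n := by
    rw [mul_add_div _ hσ, div_eq_zero_of_lt hρ, add_zero]
  have hblocks : stdBlocks (omega0 ^ σ * n + ρ) = n := by
    rw [stdBlocks, hlog, hdiv]; simp
  by_cases h : omega0 ^ σ * n + ρ = omega0 ^ σ
  · have hn1 : n = 1 := by
      rw [h, div_self hσ] at hdiv
      exact_mod_cast hdiv.symm
    rw [h, hn1]; simp
  · have hlt : 1 < omega0 ^ σ * n + ρ :=
      (Order.one_le_iff_pos.2 (opow_pos σ omega0_pos)).trans_lt (lt_of_le_of_ne hle (Ne.symm h))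
    rw [upperMean, if_neg hlt.ne', dif_neg, dif_pos hlt, hlog, hblocks]
    rw [hlog]; exact fun h' => h h'.2

theorem exists_eq_opow_mul_add {σ ξ : Ordinal.{0}} (hξ : ξ < omega0 ^ (σ + 1)) :
    ∃ (n : ℕ) (ρ : Ordinal.{0}), ρ < omega0 ^ σ ∧ ξ = omega0 ^ σ * n + ρ := by
  have hσ : omega0 ^ σ ≠ (0 : Ordinal.{0}) := (opow_pos σ omega0_pos).ne'
  rw [opow_add, opow_one, lt_mul_iff_div_lt hσ] at hξ
  obtain ⟨n, hn⟩ := lt_omega0.1 hξ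
  exact ⟨n, ξ % omega0 ^ σ, mod_lt _ hσ, by rw [← hn, div_add_mod]⟩

theorem exists_eq_opow_log_mul_add {ξ : Ordinal.{0}} (hξ : ξ ≠ 0) :
    ∃ (n : ℕ) (ρ : Ordinal.{0}), n ≠ 0 ∧ ρ < omega0 ^ log omega0 ξ ∧
      ξ = omega0 ^ log omega0 ξ * n + ρ := by
  obtain ⟨n, ρ, hρ, h⟩ := exists_eq_opow_mul_add (lt_opow_succ_log_self one_lt_omega0 ξ)
  refine ⟨n, ρ, ?_, hρ, h⟩
  rintro rfl
  have := opow_log_le_self omega0 hξ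
  rw [Nat.cast_zero, mul_zero, zero_add] at h
  exact absurd (h ▸ hρ) this.not_gt

theorem opow_mul_add_lt {σ ξ ρ : Ordinal.{0}} {n i : ℕ} (hi : i < n) (hξ : ξ < omega0 ^ σ) :
    omega0 ^ σ * (i : Ordinal.{0}) + ξ < omega0 ^ σ * n + ρ := by
  have h : (i : Ordinal.{0}) + 1 ≤ n := by exact_mod_cast hi
  calc omega0 ^ σ * (i : Ordinal.{0}) + ξ < omega0 ^ σ * i + omega0 ^ σ := by gcongr
    _ = omega0 ^ σ * ((i : Ordinal.{0}) + 1) := by rw [mul_add, mul_one]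
    _ ≤ omega0 ^ σ * n := by gcongr
    _ ≤ _ := le_self_add

/-- Recursion principle following the three defining clauses of the upper mean. -/
theorem upperMean_induction {P : Ordinal.{0} → Prop} (zero : P 0) (one : P 1)
    (opow : ∀ σ : Ordinal.{0}, σ ≠ 0 → (∀ ξ < omega0 ^ σ, P ξ) → P (omega0 ^ σ))
    (mul_add : ∀ (σ : Ordinal.{0}) (n : ℕ) (ρ : Ordinal.{0}), n ≠ 0 → ρ < omega0 ^ σ →
      P (omega0 ^ σ) → P (omega0 ^ σ * n + ρ)) (o : Ordinal.{0}) : P o := by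
  induction o using WellFoundedLT.induction with
  | _ o ih =>
    rcases eq_or_ne o 0 with rfl | ho
    · exact zero
    rcases (opow_log_le_self omega0 ho).lt_or_eq with h | h
    · obtain ⟨n, ρ, hn, hρ, hξ⟩ := exists_eq_opow_log_mul_add ho
      rw [hξ]
      exact mul_add _ n ρ hn hρ (ih _ h)
    · rw [← h]
      rcases eq_or_ne (log omega0 o) 0 with h0 | h0
      · rw [h0, opow_zero]; exact one
      · exact opow _ h0 fun ξ hξ => ih ξ (h ▸ hξ)

theorem upperMean_congr (o : Ordinal.{0}) :
    ∀ {f g : Ordinal.{0} → ℝ}, (∀ ξ < o, f ξ = g ξ) → upperMean o f = upperMean o g := by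
  induction o using upperMean_induction with
  | zero => intros; simp only [upperMean_zero]
  | one => intro f g h; rw [upperMean_one, upperMean_one, h 0 zero_lt_one]
  | opow σ hσ ih =>
    intro f g h
    rw [upperMean_opow hσ, upperMean_opow hσ]
    exact iInf_congr fun ζ => iSup_congr fun ξ => ih ξ.1 ξ.2.2 fun η hη => h η (hη.trans ξ.2.2)
  | mul_add σ n ρ hn hρ ih =>
    intro f g h
    rw [upperMean_opow_mul_add f hn hρ, upperMean_opow_mul_add g hn hρ]
    congr 1
    refine Finset.sum_congr rfl fun i hi => ih fun ξ hξ => h _ ?_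
    exact opow_mul_add_lt (Finset.mem_range.1 hi) hξ

theorem abs_upperMean_le (o : Ordinal.{0}) : ∀ {f : Ordinal.{0} → ℝ} {C : ℝ}, 0 ≤ C →
    (∀ ξ < o, |f ξ| ≤ C) → |upperMean o f| ≤ C := by
  induction o using upperMean_induction with
  | zero => intro f C hC _; simpa [upperMean_zero] using hC
  | one => intro f C _ h; rw [upperMean_one]; exact h 0 zero_lt_one
  | opow σ hσ ih =>
    intro f C hC h
    have key : ∀ ξ < omega0 ^ σ, |upperMean ξ f| ≤ C :=
      fun ξ hξ => ih ξ hξ hC fun η hη => h η (hη.trans hξ)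
    have hne : Nonempty (Set.Ico (1 : Ordinal.{0}) (omega0 ^ σ)) :=
      ⟨⟨1, le_rfl, one_lt_opow.2 ⟨one_lt_omega0, hσ⟩⟩⟩
    have hsup (ζ : Set.Ico (1 : Ordinal.{0}) (omega0 ^ σ)) :
        |⨆ ξ : Set.Ico ζ.1 (omega0 ^ σ), upperMean ξ.1 f| ≤ C := by
      have hne' : Nonempty (Set.Ico ζ.1 (omega0 ^ σ)) := ⟨⟨ζ.1, le_rfl, ζ.2.2⟩⟩
      refine abs_le.2 ⟨?_, ciSup_le fun ξ => (abs_le.1 (key ξ.1 ξ.2.2)).2⟩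
      refine (abs_le.1 (key ζ.1 ζ.2.2)).1.trans ?_
      refine le_ciSup (f := fun ξ : Set.Ico ζ.1 (omega0 ^ σ) => upperMean ξ.1 f)
        ⟨C, ?_⟩ ⟨ζ.1, le_rfl, ζ.2.2⟩
      rintro _ ⟨ξ, rfl⟩
      exact (abs_le.1 (key ξ.1 ξ.2.2)).2
    rw [upperMean_opow hσ]
    refine abs_le.2 ⟨le_ciInf fun ζ => (abs_le.1 (hsup ζ)).1, ?_⟩
    obtain ⟨ζ⟩ := hne
    refine (ciInf_le ⟨-C, ?_⟩ ζ).trans (abs_le.1 (hsup ζ)).2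
    rintro _ ⟨ζ, rfl⟩
    exact (abs_le.1 (hsup ζ)).1
  | mul_add σ n ρ hn hρ ih =>
    intro f C hC h
    rw [upperMean_opow_mul_add f hn hρ, abs_mul, abs_inv, Nat.abs_cast,
      inv_mul_le_iff₀ (by exact_mod_cast Nat.pos_of_ne_zero hn)]
    refine (Finset.abs_sum_le_sum_abs _ _).trans ((Finset.sum_le_card_nsmul _ _ C ?_).trans ?_)
    · exact fun i hi => ih hC fun ξ hξ => h _ (opow_mul_add_lt (Finset.mem_range.1 hi) hξ)
    · simp

theorem SeqBounded.exists_abs_upperMean_le {o : Ordinal.{0}} {f : Ordinal.{0} → ℝ}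
    (hf : SeqBounded o f) : ∃ C : ℝ, ∀ ξ ≤ o, |upperMean ξ f| ≤ C := by
  obtain ⟨C, hC⟩ := hf
  exact ⟨max C 0, fun ξ hξ => abs_upperMean_le ξ (le_max_right _ _)
    fun η hη => (hC η (hη.trans_le hξ)).trans (le_max_left _ _)⟩

theorem upperMean_opow_le {σ ζ : Ordinal.{0}} (hσ : σ ≠ 0) {f : Ordinal.{0} → ℝ}
    (hf : SeqBounded (omega0 ^ σ) f) {x : ℝ} (hζ : ζ < omega0 ^ σ)
    (h : ∀ ξ, ζ ≤ ξ → ξ < omega0 ^ σ → upperMean ξ f ≤ x) :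
    upperMean (omega0 ^ σ) f ≤ x := by
  obtain ⟨C, hC⟩ := hf.exists_abs_upperMean_le
  have hζ1 : max ζ 1 < omega0 ^ σ := max_lt hζ (one_lt_opow.2 ⟨one_lt_omega0, hσ⟩)
  rw [upperMean_opow hσ]
  refine (ciInf_le ⟨-C, ?_⟩ ⟨max ζ 1, le_max_right _ _, hζ1⟩).trans ?_
  · rintro _ ⟨ζ, rfl⟩
    refine (abs_le.1 (hC ζ.1 ζ.2.2.le)).1.trans ?_
    refine le_ciSup (f := fun ξ : Set.Ico ζ.1 (omega0 ^ σ) => upperMean ξ.1 f)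
      ⟨C, ?_⟩ ⟨ζ.1, le_rfl, ζ.2.2⟩
    rintro _ ⟨ξ, rfl⟩
    exact (abs_le.1 (hC ξ.1 ξ.2.2.le)).2
  · have : Nonempty (Set.Ico (max ζ 1) (omega0 ^ σ)) := ⟨⟨_, le_rfl, hζ1⟩⟩
    exact ciSup_le fun ξ => h ξ.1 ((le_max_left _ _).trans ξ.2.1) ξ.2.2

theorem exists_forall_upperMean_le {σ : Ordinal.{0}} (hσ : σ ≠ 0) {f : Ordinal.{0} → ℝ}
    (hf : SeqBounded (omega0 ^ σ) f) {x : ℝ} (hx : upperMean (omega0 ^ σ) f < x) :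
    ∃ ζ < omega0 ^ σ, ∀ ξ, ζ ≤ ξ → ξ < omega0 ^ σ → upperMean ξ f ≤ x := by
  obtain ⟨C, hC⟩ := hf.exists_abs_upperMean_le
  have : Nonempty (Set.Ico (1 : Ordinal.{0}) (omega0 ^ σ)) :=
    ⟨⟨1, le_rfl, one_lt_opow.2 ⟨one_lt_omega0, hσ⟩⟩⟩
  rw [upperMean_opow hσ] at hx
  obtain ⟨ζ, hζ⟩ := exists_lt_of_ciInf_lt hx
  refine ⟨ζ.1, ζ.2.2, fun ξ h1 h2 => le_trans ?_ hζ.le⟩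
  refine le_ciSup (f := fun ξ : Set.Ico ζ.1 (omega0 ^ σ) => upperMean ξ.1 f)
    ⟨C, ?_⟩ ⟨ξ, h1, h2⟩
  rintro _ ⟨ξ, rfl⟩
  exact (abs_le.1 (hC ξ.1 ξ.2.2.le)).2

theorem upperMean_opow_eq_of_shift {σ a : Ordinal.{0}} (hσ : σ ≠ 0) (ha : a < omega0 ^ σ)
    {f g : Ordinal.{0} → ℝ} (hf : SeqBounded (omega0 ^ σ) f) (hg : SeqBounded (omega0 ^ σ) g)
    (h : ∀ ε > 0, ∃ ζ < omega0 ^ σ, ∀ ξ, ζ ≤ ξ → ξ < omega0 ^ σ →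
      |upperMean (a + ξ) f - upperMean ξ g| ≤ ε) :
    upperMean (omega0 ^ σ) f = upperMean (omega0 ^ σ) g := by
  have hadd := isPrincipal_add_omega0_opow σ
  apply le_antisymm
  · refine le_of_forall_pos_le_add fun ε hε => ?_
    obtain ⟨ζ₁, hζ₁, h₁⟩ := h (ε / 2) (half_pos hε)
    obtain ⟨ζ₂, hζ₂, h₂⟩ := exists_forall_upperMean_le hσ hg
      (lt_add_of_pos_right (upperMean (omega0 ^ σ) g) (half_pos hε))
    refine upperMean_opow_le hσ hf (hadd ha (max_lt hζ₁ hζ₂)) fun η hη hη' => ?_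
    have hle : a ≤ η := le_self_add.trans hη
    obtain ⟨ξ, rfl⟩ := exists_add_of_le hle
    have hξ : max ζ₁ ζ₂ ≤ ξ := (add_le_add_iff_left a).1 hη
    have hξ' : ξ < omega0 ^ σ := le_add_self.trans_lt hη'
    have e₁ := (abs_le.1 (h₁ ξ ((le_max_left _ _).trans hξ) hξ')).2
    have e₂ := h₂ ξ ((le_max_right _ _).trans hξ) hξ'
    linarith
  · refine le_of_forall_pos_le_add fun ε hε => ?_
    obtain ⟨ζ₁, hζ₁, h₁⟩ := h (ε / 2) (half_pos hε)
    obtain ⟨ζ₂, hζ₂, h₂⟩ := exists_forall_upperMean_le hσ hf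
      (lt_add_of_pos_right (upperMean (omega0 ^ σ) f) (half_pos hε))
    refine upperMean_opow_le hσ hg (max_lt hζ₁ hζ₂) fun ξ hξ hξ' => ?_
    have e₁ := (abs_le.1 (h₁ ξ ((le_max_left _ _).trans hξ) hξ')).1
    have e₂ := h₂ (a + ξ) (((le_max_right _ _).trans hξ).trans le_add_self) (hadd ha hξ')
    linarith

theorem concatSeq_of_lt {a ξ : Ordinal.{0}} (r s : Ordinal.{0} → ℝ) (h : ξ < a) :
    concatSeq a r s ξ = r ξ := if_pos h

theorem concatSeq_add (a ξ : Ordinal.{0}) (r s : Ordinal.{0} → ℝ) :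
    concatSeq a r s (a + ξ) = s ξ := by
  simp [concatSeq]

theorem concatSeq_assoc (a b : Ordinal.{0}) (r s : Ordinal.{0} → ℝ) :
    concatSeq (a + b) r s = concatSeq a r (concatSeq b (fun ξ => r (a + ξ)) s) := by
  funext ξ
  rcases lt_or_ge ξ a with h | h
  · rw [concatSeq_of_lt _ _ h, concatSeq_of_lt _ _ (h.trans_le le_self_add)]
  · obtain ⟨η, rfl⟩ := exists_add_of_le h
    rw [concatSeq_add]
    simp [concatSeq]

theorem SeqBounded.concatSeq {a b : Ordinal.{0}} {r s : Ordinal.{0} → ℝ} (hr : SeqBounded a r)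
    (hs : SeqBounded b s) : SeqBounded (a + b) (concatSeq a r s) := by
  obtain ⟨C, hC⟩ := hr
  obtain ⟨D, hD⟩ := hs
  refine ⟨max C D, fun ξ hξ => ?_⟩
  rcases lt_or_ge ξ a with h | h
  · rw [concatSeq_of_lt _ _ h]
    exact (hC ξ h).trans (le_max_left _ _)
  · obtain ⟨η, rfl⟩ := exists_add_of_le h
    rw [concatSeq_add]
    exact (hD η ((add_lt_add_iff_left a).1 hξ)).trans (le_max_right _ _)

/-- If prepending `r` does not change the upper means of sequences of length `ω ^ log ω b`,
it does not change those of sequences of length `b`. -/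
theorem upperMean_concatSeq_of_opow {a b : Ordinal.{0}} {r s : Ordinal.{0} → ℝ} (hb : b ≠ 0)
    (ha : a < omega0 ^ log omega0 b)
    (h : upperMean (omega0 ^ log omega0 b) (concatSeq a r s) =
      upperMean (omega0 ^ log omega0 b) s) :
    upperMean b (concatSeq a r s) = upperMean b s := by
  obtain ⟨n, ρ, hn, hρ, hb'⟩ := exists_eq_opow_log_mul_add hb
  rw [hb', upperMean_opow_mul_add _ hn hρ, upperMean_opow_mul_add _ hn hρ]
  congr 1
  refine Finset.sum_congr rfl fun i _ => ?_
  rcases Nat.eq_zero_or_pos i with rfl | hi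
  · simpa using h
  · congr 1
    funext ξ
    have hle : omega0 ^ log omega0 b ≤ omega0 ^ log omega0 b * (i : Ordinal.{0}) + ξ :=
      (le_mul_left _ (by exact_mod_cast hi)).trans le_self_add
    conv_lhs => rw [← add_of_omega0_opow_le ha hle, concatSeq_add]

theorem abs_upperMean_concatSeq_opow_sub_le {σ ρ : Ordinal.{0}} {n : ℕ} (hn : n ≠ 0)
    (hρ : ρ < omega0 ^ σ) {r s : Ordinal.{0} → ℝ} {C : ℝ}
    (hr : |upperMean (omega0 ^ σ) r| ≤ C) (hs : |upperMean (omega0 ^ σ * n + ρ) s| ≤ C) :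
    |upperMean (omega0 ^ σ + (omega0 ^ σ * n + ρ)) (concatSeq (omega0 ^ σ) r s) -
      upperMean (omega0 ^ σ * n + ρ) s| ≤ 2 * C / (n + 1) := by
  have hlen : omega0 ^ σ + (omega0 ^ σ * n + ρ) =
      omega0 ^ σ * ((n + 1 : ℕ) : Ordinal.{0}) + ρ := by
    rw [add_comm n 1, Nat.cast_add, Nat.cast_one, mul_add, mul_one, add_assoc]
  have hblock (i : ℕ) : (fun ξ => concatSeq (omega0 ^ σ) r s
      (omega0 ^ σ * ((i + 1 : ℕ) : Ordinal.{0}) + ξ)) =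
      fun ξ => s (omega0 ^ σ * (i : Ordinal.{0}) + ξ) := by
    funext ξ
    rw [add_comm i 1, Nat.cast_add, Nat.cast_one, mul_add, mul_one, add_assoc, concatSeq_add]
  have hfirst : upperMean (omega0 ^ σ) (fun ξ => concatSeq (omega0 ^ σ) r s
      (omega0 ^ σ * ((0 : ℕ) : Ordinal.{0}) + ξ)) = upperMean (omega0 ^ σ) r :=
    upperMean_congr _ fun ξ hξ => by simp [concatSeq_of_lt _ _ hξ]
  have hn0 : (n : ℝ) ≠ 0 := by exact_mod_cast hn
  have hn1 : (0 : ℝ) < n + 1 := by positivity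
  have hS := upperMean_opow_mul_add s hn hρ
  rw [eq_inv_mul_iff_mul_eq₀ hn0] at hS
  rw [hlen, upperMean_opow_mul_add _ n.succ_ne_zero hρ, Finset.sum_range_succ', hfirst]
  simp only [hblock]
  rw [← hS]
  set A := upperMean (omega0 ^ σ) r
  set B := upperMean (omega0 ^ σ * n + ρ) s
  have e : ((n + 1 : ℕ) : ℝ)⁻¹ * (n * B + A) - B = (A - B) / (n + 1) := by
    push_cast; field_simp; ring
  rw [e, abs_div, abs_of_pos hn1]
  gcongr
  linarith [abs_sub A B]

theorem upperMean_opow_concatSeq {σ : Ordinal.{0}} : ∀ {a : Ordinal.{0}}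
    {r s : Ordinal.{0} → ℝ}, a < omega0 ^ σ → SeqBounded a r → SeqBounded (omega0 ^ σ) s →
    upperMean (omega0 ^ σ) (concatSeq a r s) = upperMean (omega0 ^ σ) s := by
  induction σ using WellFoundedLT.induction with
  | _ σ ih =>
  rcases eq_or_ne σ 0 with rfl | hσ
  · intro a r s ha _ _
    rw [opow_zero, Order.lt_one_iff] at ha
    subst ha
    congr 1
    funext ξ
    simpa using concatSeq_add 0 ξ r s
  have hbdd {a : Ordinal.{0}} {r s : Ordinal.{0} → ℝ} (ha : a < omega0 ^ σ)
      (hr : SeqBounded a r) (hs : SeqBounded (omega0 ^ σ) s) :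
      SeqBounded (omega0 ^ σ) (concatSeq a r s) := by
    simpa only [add_omega0_opow ha] using hr.concatSeq hs
  have small {τ a : Ordinal.{0}} {r s : Ordinal.{0} → ℝ} (hτ : τ < σ) (ha : a < omega0 ^ τ)
      (hr : SeqBounded a r) (hs : SeqBounded (omega0 ^ σ) s) :
      upperMean (omega0 ^ σ) (concatSeq a r s) = upperMean (omega0 ^ σ) s := by
    have hτσ : omega0 ^ τ < omega0 ^ σ := (opow_lt_opow_iff_right one_lt_omega0).2 hτ
    refine upperMean_opow_eq_of_shift hσ (ha.trans hτσ) (hbdd (ha.trans hτσ) hr hs) hs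
      fun ε hε => ⟨omega0 ^ τ, hτσ, fun ξ hξ hξσ => ?_⟩
    have hξ0 : ξ ≠ 0 := ((opow_pos τ omega0_pos).trans_le hξ).ne'
    have haξ : a < omega0 ^ log omega0 ξ := ha.trans_le
      (opow_le_opow_right omega0_pos (le_log_of_opow_le one_lt_omega0 hξ))
    obtain ⟨C, hC⟩ := hs
    rw [add_of_omega0_opow_le ha hξ, upperMean_concatSeq_of_opow hξ0 haξ, _root_.sub_self, abs_zero]
    · exact hε.le
    · refine ih _ ((lt_opow_iff_log_lt one_lt_omega0 hξ0).1 hξσ) haξ hr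
        ⟨C, fun η hη => hC η ?_⟩
      exact hη.trans ((opow_log_le_self _ hξ0).trans_lt hξσ)
  have block {τ : Ordinal.{0}} {r s : Ordinal.{0} → ℝ} (hτ : τ < σ)
      (hr : SeqBounded (omega0 ^ τ) r) (hs : SeqBounded (omega0 ^ σ) s) :
      upperMean (omega0 ^ σ) (concatSeq (omega0 ^ τ) r s) = upperMean (omega0 ^ σ) s := by
    have hτ1 : τ < τ + 1 := lt_add_one τ
    rcases (Order.add_one_le_of_lt hτ).lt_or_eq with h | rfl
    · exact small h ((opow_lt_opow_iff_right one_lt_omega0).2 hτ1) hr hs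
    have hτσ : omega0 ^ τ < omega0 ^ (τ + 1) := (opow_lt_opow_iff_right one_lt_omega0).2 hτ
    obtain ⟨C, hC⟩ := hr.exists_abs_upperMean_le
    obtain ⟨D, hD⟩ := hs.exists_abs_upperMean_le
    refine upperMean_opow_eq_of_shift hσ hτσ (hbdd hτσ hr hs) hs fun ε hε => ?_
    obtain ⟨K, hK⟩ := exists_nat_gt (2 * max C D / ε)
    refine ⟨omega0 ^ τ * ((K + 1 : ℕ) : Ordinal.{0}), ?_, fun ξ hξ hξσ => ?_⟩
    · exact opow_mul_lt_opow (natCast_lt_omega0 _) hτ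
    obtain ⟨n, ρ, hρ, rfl⟩ := exists_eq_opow_mul_add hξσ
    have hKn : K < n := by
      by_contra hnK
      have := opow_mul_add_lt (ρ := 0) (Nat.lt_succ_of_le (not_lt.1 hnK)) hρ
      rw [add_zero] at this
      exact this.not_ge hξ
    refine (abs_upperMean_concatSeq_opow_sub_le (Nat.ne_zero_of_lt hKn) hρ
      ((hC _ le_rfl).trans (le_max_left C D)) ((hD _ hξσ.le).trans (le_max_right C D))).trans ?_
    have hKn' : (K : ℝ) < n := by exact_mod_cast hKn
    rw [div_lt_iff₀ hε] at hK
    rw [div_le_iff₀ (by positivity)]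
    nlinarith
  intro a r s ha
  obtain ⟨τ, hτ, n, hn⟩ := (lt_omega0_opow hσ).1 ha
  clear ha
  induction n generalizing a r with
  | zero => simp at hn
  | succ n ihn =>
    intro hr hs
    rcases lt_or_ge a (omega0 ^ τ) with h | h
    · exact small hτ h hr hs
    obtain ⟨a, rfl⟩ := exists_add_of_le h
    have ha : a < omega0 ^ τ * (n : Ordinal.{0}) := by
      rw [add_comm n 1, Nat.cast_add, Nat.cast_one, mul_add, mul_one] at hn
      exact (add_lt_add_iff_left _).1 hn
    have haσ : a < omega0 ^ σ := ha.trans (opow_mul_lt_opow (natCast_lt_omega0 _) hτ)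
    obtain ⟨C, hC⟩ := hr
    have hr₁ : SeqBounded (omega0 ^ τ) r := ⟨C, fun ξ hξ => hC ξ (hξ.trans_le h)⟩
    have hr₂ : SeqBounded a (fun ξ => r (omega0 ^ τ + ξ)) :=
      ⟨C, fun ξ hξ => hC _ (by gcongr)⟩
    rw [concatSeq_assoc, block hτ hr₁ (hbdd haσ hr₂ hs), ihn ha hr₂ hs]

theorem lt_opow_log_of_add_eq {a b : Ordinal.{0}} (hb : b ≠ 0) (h : a + b = b) :
    a < omega0 ^ log omega0 b := by
  by_contra! hle
  obtain ⟨n, ρ, -, hρ, hb'⟩ := exists_eq_opow_log_mul_add hb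
  have h1 : omega0 ^ log omega0 b + b ≤ b := by
    conv_rhs => rw [← h]
    gcongr
  have h2 : b < omega0 ^ log omega0 b + b := by
    have h3 : b < omega0 ^ log omega0 b * ((n + 1 : ℕ) : Ordinal.{0}) + 0 := by
      conv_lhs => rw [hb']
      exact opow_mul_add_lt n.lt_succ_self hρ
    refine h3.trans_le ?_
    rw [add_zero, add_comm n 1, Nat.cast_add, Nat.cast_one, mul_add, mul_one]
    gcongr
    conv_rhs => rw [hb']
    exact le_self_add
  exact h2.not_ge h1

/-- Theorem: domination.  If `r` and `s` are bounded transfinite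
sequences of reals of nonzero lengths `a` and `b` with `a + b = b`, then
`M̄(r ⊕ s) = M̄(s)`. -/
theorem upperMean_concat_of_add_eq (a b : Ordinal.{0}) (r s : Ordinal.{0} → ℝ)
    (ha : a ≠ 0) (hb : b ≠ 0)
    (hr : SeqBounded a r) (hs : SeqBounded b s)
    (hab : a + b = b) :
    upperMean (a + b) (concatSeq a r s) = upperMean b s := by
  have hlt := lt_opow_log_of_add_eq hb hab
  rw [hab]
  refine upperMean_concatSeq_of_opow hb hlt (upperMean_opow_concatSeq hlt hr ?_)
  obtain ⟨C, hC⟩ := hs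
  exact ⟨C, fun ξ hξ => hC ξ (hξ.trans_le (opow_log_le_self _ hb))⟩
end

section
/- Let r and s be bounded transfinite sequences of reals of the same nonzero length with r_(ξ) ≤ s_(ξ) for all ξ < ℓ(s). Then inf_{ξ < ℓ(r)} r_(ξ) ≤ M̄(r) ≤ M̄(s) ≤ sup_{ξ < ℓ(s)} s_(ξ). -/
open Ordinal

theorem natCast_stdBlocks (o : Ordinal.{0}) :
    (stdBlocks o : Ordinal.{0}) = o / omega0 ^ log omega0 o := by
  obtain ⟨n, hn⟩ := lt_omega0.1 (div_opow_log_lt o one_lt_omega0)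
  simp [stdBlocks, hn]

theorem stdBlocks_pos {o : Ordinal.{0}} (ho : o ≠ 0) : 0 < stdBlocks o := by
  have h := div_opow_log_pos omega0 ho
  rw [← natCast_stdBlocks o] at h
  exact_mod_cast h

theorem mul_add_lt_of_lt_stdBlocks {o ξ : Ordinal.{0}} {i : ℕ}
    (hi : i < stdBlocks o) (hξ : ξ < omega0 ^ log omega0 o) :
    omega0 ^ log omega0 o * (i : Ordinal.{0}) + ξ < o := by
  have hi' : ((i : Ordinal.{0}) + 1) ≤ o / omega0 ^ log omega0 o := by
    rw [← natCast_stdBlocks o]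
    exact_mod_cast hi
  calc omega0 ^ log omega0 o * (i : Ordinal.{0}) + ξ
      < omega0 ^ log omega0 o * (i : Ordinal.{0}) + omega0 ^ log omega0 o := by gcongr
    _ = omega0 ^ log omega0 o * ((i : Ordinal.{0}) + 1) := (mul_add_one _ _).symm
    _ ≤ omega0 ^ log omega0 o * (o / omega0 ^ log omega0 o) := by gcongr
    _ ≤ o := mul_div_le _ _

/-- The average of finitely many numbers in `[a, b]` lies in `[a, b]`, and is monotone. -/
theorem average_mono_bounds {n : ℕ} (hn : 0 < n) {x y : ℕ → ℝ} {a b : ℝ}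
    (h : ∀ i < n, a ≤ x i ∧ x i ≤ y i ∧ y i ≤ b) :
    a ≤ (n : ℝ)⁻¹ * ∑ i ∈ Finset.range n, x i ∧
      (n : ℝ)⁻¹ * ∑ i ∈ Finset.range n, x i ≤ (n : ℝ)⁻¹ * ∑ i ∈ Finset.range n, y i ∧
      (n : ℝ)⁻¹ * ∑ i ∈ Finset.range n, y i ≤ b := by
  have hn' : (0 : ℝ) < n := by exact_mod_cast hn
  refine ⟨?_, ?_, ?_⟩
  · rw [le_inv_mul_iff₀ hn']
    simpa using Finset.card_nsmul_le_sum (Finset.range n) x a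
      fun i hi => (h i (Finset.mem_range.1 hi)).1
  · gcongr with i hi
    exact (h i (Finset.mem_range.1 hi)).2.1
  · rw [inv_mul_le_iff₀ hn']
    simpa using Finset.sum_le_card_nsmul (Finset.range n) y b
      fun i hi => (h i (Finset.mem_range.1 hi)).2.2

theorem ciSup_mono_bounds {ι : Type*} [Nonempty ι] {x y : ι → ℝ} {a b : ℝ}
    (h : ∀ i, a ≤ x i ∧ x i ≤ y i ∧ y i ≤ b) :
    a ≤ ⨆ i, x i ∧ ⨆ i, x i ≤ ⨆ i, y i ∧ ⨆ i, y i ≤ b := by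
  have hy : BddAbove (Set.range y) := ⟨b, Set.forall_mem_range.2 fun i => (h i).2.2⟩
  have hx : BddAbove (Set.range x) :=
    ⟨b, Set.forall_mem_range.2 fun i => (h i).2.1.trans (h i).2.2⟩
  obtain ⟨i⟩ := ‹Nonempty ι›
  exact ⟨le_ciSup_of_le hx i (h i).1, ciSup_mono hy fun i => (h i).2.1,
    ciSup_le fun i => (h i).2.2⟩

theorem ciInf_mono_bounds {ι : Type*} [Nonempty ι] {x y : ι → ℝ} {a b : ℝ}
    (h : ∀ i, a ≤ x i ∧ x i ≤ y i ∧ y i ≤ b) :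
    a ≤ ⨅ i, x i ∧ ⨅ i, x i ≤ ⨅ i, y i ∧ ⨅ i, y i ≤ b := by
  have hx : BddBelow (Set.range x) := ⟨a, Set.forall_mem_range.2 fun i => (h i).1⟩
  have hy : BddBelow (Set.range y) :=
    ⟨a, Set.forall_mem_range.2 fun i => (h i).1.trans (h i).2.1⟩
  obtain ⟨i⟩ := ‹Nonempty ι›
  exact ⟨le_ciInf fun i => (h i).1, ciInf_mono hx fun i => (h i).2.1,
    ciInf_le_of_le hy i (h i).2.2⟩

theorem upperMean_mono_bounds_of_forall_mem {a b : ℝ} (o : Ordinal.{0}) (ho : o ≠ 0)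
    (r s : Ordinal.{0} → ℝ) (h : ∀ ξ < o, a ≤ r ξ ∧ r ξ ≤ s ξ ∧ s ξ ≤ b) :
    a ≤ upperMean o r ∧ upperMean o r ≤ upperMean o s ∧ upperMean o s ≤ b := by
  induction o using WellFoundedLT.induction generalizing r s with
  | ind o ih =>
  rw [upperMean.eq_def o r, upperMean.eq_def o s]
  split_ifs with h0 h1 h2
  · exact h 0 (pos_iff_ne_zero.2 ho)
  · have : Nonempty (Set.Ico (1 : Ordinal.{0}) o) := ⟨⟨1, le_rfl, h1.1⟩⟩
    refine ciInf_mono_bounds fun ζ => ?_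
    have : Nonempty (Set.Ico ζ.1 o) := ⟨⟨ζ.1, le_rfl, ζ.2.2⟩⟩
    exact ciSup_mono_bounds fun ξ => ih ξ.1 ξ.2.2
      (zero_lt_one.trans_le (ζ.2.1.trans ξ.2.1)).ne' r s
      fun η hη => h η (hη.trans ξ.2.2)
  · have hlt : omega0 ^ log omega0 o < o :=
      (opow_log_le_self _ ho).lt_of_ne fun e => h1 ⟨h2, e.symm⟩
    exact average_mono_bounds (stdBlocks_pos ho) fun i hi =>
      ih _ hlt (opow_pos _ omega0_pos).ne' _ _
        fun ξ hξ => h _ (mul_add_lt_of_lt_stdBlocks hi hξ)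
  · exact absurd ((Order.one_le_iff_ne_zero.2 ho).lt_of_ne' h0) h2

/-- monotonicity and bounds for the upper mean.  For bounded
sequences `r ≤ s` (pointwise) of the same nonzero length `o`:
`inf_{ξ<o} r ξ ≤ M̄(r) ≤ M̄(s) ≤ sup_{ξ<o} s ξ`. -/
theorem upperMean_mono_bounds (o : Ordinal.{0}) (ho : o ≠ 0) (r s : Ordinal.{0} → ℝ)
    (hr : SeqBounded o r) (hs : SeqBounded o s)
    (hle : ∀ ξ < o, r ξ ≤ s ξ) :
    (⨅ ξ : Set.Iio o, r ξ.1) ≤ upperMean o r ∧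
      upperMean o r ≤ upperMean o s ∧
      upperMean o s ≤ ⨆ ξ : Set.Iio o, s ξ.1 := by
  obtain ⟨C, hC⟩ := hr
  obtain ⟨D, hD⟩ := hs
  have hbelow : BddBelow (Set.range fun ξ : Set.Iio o => r ξ.1) :=
    ⟨-C, Set.forall_mem_range.2 fun ξ => (abs_le.1 (hC ξ.1 ξ.2)).1⟩
  have habove : BddAbove (Set.range fun ξ : Set.Iio o => s ξ.1) :=
    ⟨D, Set.forall_mem_range.2 fun ξ => (abs_le.1 (hD ξ.1 ξ.2)).2⟩
  exact upperMean_mono_bounds_of_forall_mem o ho r s fun ξ hξ =>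
    ⟨ciInf_le hbelow ⟨ξ, hξ⟩, hle ξ hξ, le_ciSup habove ⟨ξ, hξ⟩⟩
end
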